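/- If A is a cancellative totally ordered Wajsberg hoop and a ∈ A with a ≠ 1, then the subalgebra of A generated by a is isomorphic to C_ω, the negative cone of the integers (equivalently, ⟨ℕ, +, truncated subtraction, 0⟩ with a^l → a^m = a^{max(l−m,0)}). -/

import Mathlib

/-- A hoop: a commutative (integral, residuated) monoid with a residuum `→`,
axiomatized equationally by `x→x = 1`, divisibility `x·(x→y) = y·(y→x)` and
`(x·y)→z = x→(y→z)`.  The order is `a ≤ b ↔ a→b = 1`. -/
class Hoop (A : Type*) extends CommMonoid A where
  himp : A → A → A
  himp_self : ∀ a : A, himp a a = 1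
  div_eq : ∀ a b : A, a * himp a b = b * himp b a
  himp_mul : ∀ a b c : A, himp (a * b) c = himp a (himp b c)

/-- A Wajsberg hoop: a hoop satisfying Tanaka's equation. -/
class WajsbergHoop (A : Type*) extends Hoop A where
  tanaka : ∀ a b : A, himp (himp a b) b = himp (himp b a) a

/-- Membership in the subalgebra generated by `a`: the closure of `{a}` under
the product `m`, the residuum `i`, and containing the unit `o`. -/
inductive HGen {A : Type*} (m : A → A → A) (i : A → A → A) (o : A) (a : A) : A → Prop
  | base : HGen m i o a a
  | one : HGen m i o a o
  | mul {x y} : HGen m i o a x → HGen m i o a y → HGen m i o a (m x y)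
  | imp {x y} : HGen m i o a x → HGen m i o a y → HGen m i o a (i x y)

/-- in a cancellative totally ordered Wajsberg hoop `A`, the subalgebra
generated by any `a ≠ 1` is isomorphic to `C_ω` — here presented as `⟨ℕ, +, truncated
subtraction, 0⟩` (exponents of powers of the generator of the negative cone of `ℤ`,
with `a^l → a^m = a^{max(m-l,0)}`). -/
theorem cancellative_chain_subalgebra_iso_Comega (A : Type*) [WajsbergHoop A]
    (htot : ∀ a b : A, Hoop.himp a b = 1 ∨ Hoop.himp b a = 1)
    (hcanc : ∀ a b c : A, a * c = b * c → a = b)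
    (a : A) (ha : a ≠ 1) :
    ∃ f : ℕ → A,
      Function.Injective f ∧ f 0 = 1 ∧ f 1 = a ∧
      (∀ l m : ℕ, f (l + m) = f l * f m) ∧
      (∀ l m : ℕ, Hoop.himp (f l) (f m) = f (m - l)) ∧
      Set.range f = {x | HGen (· * ·) Hoop.himp 1 a x} := by
  have hbc : ∀ b c : A, Hoop.himp 1 (Hoop.himp b c) = Hoop.himp b c := fun b c => by
    rw [← Hoop.himp_mul, one_mul]
  have hcl : ∀ x y : A, x * y = x → y = 1 := fun x y h =>
    hcanc y 1 x (by rw [one_mul, mul_comm, h])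
  have hd : ∀ x : A, x * Hoop.himp x 1 = Hoop.himp 1 x := fun x => by
    rw [Hoop.div_eq, one_mul]
  have h1 : ∀ x : A, Hoop.himp x 1 = 1 := fun x => by
    have hu : Hoop.himp (Hoop.himp x 1) 1 = 1 :=
      hcl (Hoop.himp x 1) _ (by rw [hd, hbc])
    have hp : Hoop.himp (Hoop.himp 1 x) 1 = Hoop.himp x 1 := by
      rw [← hd x, Hoop.himp_mul, hu]
    have h3 := hd (Hoop.himp 1 x)
    rw [hp, hbc] at h3
    exact hcl _ _ h3
  have h2 : ∀ x : A, Hoop.himp 1 x = x := fun x => by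
    rw [← hd, h1, mul_one]
  have h4 : ∀ x y : A, Hoop.himp (x * y) x = 1 := fun x y => by
    rw [mul_comm, Hoop.himp_mul, Hoop.himp_self, h1]
  have h5 : ∀ x y : A, Hoop.himp x (x * y) = y := fun x y => by
    have h := Hoop.div_eq x (x * y)
    rw [h4, mul_one, mul_comm x, mul_comm x y] at h
    have := hcanc _ _ _ h
    rwa [mul_comm x y]
  have hinj : ∀ l k : ℕ, a ^ l = a ^ (l + (k + 1)) → False := fun l k h => by
    rw [pow_add] at h
    have h6 := hcl _ _ h.symm
    rw [pow_succ'] at h6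
    have h7 := h4 a (a ^ k)
    rw [h6, h2] at h7
    exact ha h7
  have himp : ∀ l m : ℕ, Hoop.himp (a ^ l) (a ^ m) = a ^ (m - l) := fun l m => by
    rcases le_total l m with h | h
    · obtain ⟨k, rfl⟩ := Nat.exists_eq_add_of_le h
      rw [pow_add, h5, Nat.add_sub_cancel_left]
    · obtain ⟨k, rfl⟩ := Nat.exists_eq_add_of_le h
      rw [pow_add, h4, Nat.sub_eq_zero_of_le h, pow_zero]
  refine ⟨fun n => a ^ n, ?_, pow_zero a, pow_one a, fun l m => pow_add a l m, himp, ?_⟩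
  · intro l m h
    rcases lt_trichotomy l m with g | g | g
    · obtain ⟨k, rfl⟩ := Nat.exists_eq_add_of_lt g
      exact (hinj l k h).elim
    · exact g
    · obtain ⟨k, rfl⟩ := Nat.exists_eq_add_of_lt g
      exact (hinj m k h.symm).elim
  · ext x
    constructor
    · rintro ⟨n, rfl⟩
      show HGen _ _ _ _ (a ^ n)
      induction n with
      | zero => rw [pow_zero]; exact HGen.one
      | succ n ih => rw [pow_succ]; exact HGen.mul ih HGen.base
    · intro h
      induction h with
      | base => exact ⟨1, pow_one a⟩
      | one => exact ⟨0, pow_zero a⟩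
      | mul _ _ hx hy =>
        obtain ⟨n, rfl⟩ := hx
        obtain ⟨m, rfl⟩ := hy
        exact ⟨n + m, pow_add a n m⟩
      | imp _ _ hx hy =>
        obtain ⟨n, rfl⟩ := hx
        obtain ⟨m, rfl⟩ := hy
        exact ⟨m - n, (himp n m).symm⟩
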